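/- arXiv:0708.0981 — 2 statements merged into one kernel-verified Lean document; each statement's English description precedes it below -/
import Mathlib

section
/- Let A ≥ 0 be a real number, U(x) = 0 if x ≤ A and U(x) = 1 if x > A, and let X be Poisson with mean λ > 0. The V estimator is V(x) = x·1{x ≥ ⌊A⌋ + 2} (so V(x) = 0 for x ≤ ⌊A⌋ + 1). Then V(X) is an admissible estimator of U(X)λ under squared error loss: for every function δ : ℕ → ℝ, if E_λ[(δ(X) − U(X)λ)²] ≤ E_λ[(V(X) − U(X)λ)²] for every λ > 0, then E_λ[(δ(X) − U(X)λ)²] = E_λ[(V(X) − U(X)λ)²] for every λ > 0. -/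
/-- Poisson probability mass function with mean `λ`. -/
noncomputable def poissonPmf (l : ℝ) (x : ℕ) : ℝ :=
  Real.exp (-l) * l ^ x / (Nat.factorial x : ℝ)

/-- Squared error risk of the estimator `δ` of `U(X)λ`, where
`U(x) = 1{x > A}` and `X` is Poisson with mean `λ`. -/
noncomputable def sqRisk (A l : ℝ) (δ : ℕ → ℝ) : ENNReal :=
  ∑' x : ℕ,
    ENNReal.ofReal ((δ x - (if A < (x : ℝ) then (1 : ℝ) else 0) * l) ^ 2 * poissonPmf l x)

open Set in
/-- A function on the line with `2 f' ≤ -f²` everywhere is nowhere negative: otherwise `1 / f` would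
reach `0` in finite time. -/
lemma nonneg_of_two_mul_deriv_le_neg_sq {f f' : ℝ → ℝ} (hf : ∀ t, HasDerivAt f (f' t) t)
    (h : ∀ t, 2 * f' t ≤ -(f t) ^ 2) (a : ℝ) : 0 ≤ f a := by
  by_contra! ha
  have hanti : Antitone f := antitone_of_deriv_nonpos (fun t => (hf t).differentiableAt)
    fun t => by rw [(hf t).deriv]; nlinarith [h t, sq_nonneg (f t)]
  have hneg : ∀ t, a ≤ t → f t < 0 := fun t ht => (hanti ht).trans_lt ha
  have hd : ∀ t, a ≤ t → HasDerivAt (fun s => (f s)⁻¹ - s / 2) (-f' t / f t ^ 2 - 1 / 2) t :=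
    fun t ht => ((hf t).fun_inv (hneg t ht).ne).sub ((hasDerivAt_id t).div_const 2)
  have hmono : MonotoneOn (fun s => (f s)⁻¹ - s / 2) (Ici a) := by
    refine monotoneOn_of_deriv_nonneg (convex_Ici a)
      (fun t ht => (hd t ht).continuousAt.continuousWithinAt)
      (fun t ht => (hd t (interior_subset ht)).differentiableAt.differentiableWithinAt)
      fun t ht => ?_
    have ht' : a ≤ t := interior_subset ht
    have hpos : 0 < f t ^ 2 := sq_pos_of_neg (hneg t ht')
    rw [(hd t ht').deriv, sub_nonneg, le_div_iff₀ hpos]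
    linarith [h t]
  have hinv : (f a)⁻¹ < 0 := inv_lt_zero.2 ha
  have hb : a ≤ a - 2 * (f a)⁻¹ := by linarith
  have key := hmono self_mem_Ici (mem_Ici.2 hb) hb
  have hbneg := inv_lt_zero.2 (hneg _ hb)
  simp only at key
  linarith

lemma eq_zero_of_two_mul_deriv_le_neg_sq {f f' : ℝ → ℝ} (hf : ∀ t, HasDerivAt f (f' t) t)
    (h : ∀ t, 2 * f' t ≤ -(f t) ^ 2) (a : ℝ) : f a = 0 := by
  refine le_antisymm ?_ (nonneg_of_two_mul_deriv_le_neg_sq hf h a)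
  have hd : ∀ t, HasDerivAt (fun s => -f (-s)) (f' (-t)) t := fun t =>
    (((hf (-t)).comp t (hasDerivAt_neg t)).neg).congr_deriv (by ring)
  have := nonneg_of_two_mul_deriv_le_neg_sq hd (fun t => by simpa using h (-t)) (-a)
  simpa using this

lemma eq_zero_of_two_mul_mul_deriv_le_neg_sq {f f' : ℝ → ℝ}
    (hf : ∀ l, 0 < l → HasDerivAt f (f' l) l)
    (h : ∀ l, 0 < l → 2 * (l * f' l) ≤ -(f l) ^ 2) {l : ℝ} (hl : 0 < l) : f l = 0 := by
  have := eq_zero_of_two_mul_deriv_le_neg_sq (f := fun t => f (Real.exp t))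
    (f' := fun t => f' (Real.exp t) * Real.exp t)
    (fun t => (hf _ (Real.exp_pos t)).comp t (Real.hasDerivAt_exp t))
    (fun t => by simpa [mul_comm] using h _ (Real.exp_pos t)) (Real.log l)
  simpa [Real.exp_log hl] using this

lemma poissonPmf_pos {l : ℝ} (hl : 0 < l) (x : ℕ) : 0 < poissonPmf l x := by
  unfold poissonPmf; positivity

lemma hasSum_poissonPmf (l : ℝ) : HasSum (poissonPmf l) 1 := by
  have := (NormedSpace.expSeries_div_hasSum_exp (𝔸 := ℝ) l).mul_left (Real.exp (-l))
  rw [← Real.exp_eq_exp_ℝ, ← Real.exp_add, neg_add_cancel, Real.exp_zero] at this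
  exact (funext fun x => mul_div_assoc _ _ _ : poissonPmf l = _) ▸ this

lemma summable_succ_sq_mul_pow_div_factorial {l : ℝ} (hl : 0 < l) :
    Summable fun x : ℕ => ((x : ℝ) + 1) ^ 2 * (l ^ x / (Nat.factorial x : ℝ)) := by
  refine Summable.of_nonneg_of_le (fun x => by positivity) (fun x => ?_)
    (Real.summable_pow_div_factorial (4 * l))
  have h : (x : ℝ) + 1 ≤ 2 ^ x := mod_cast Nat.lt_two_pow_self
  have h4 : ((x : ℝ) + 1) ^ 2 ≤ 4 ^ x := by
    calc ((x : ℝ) + 1) ^ 2 ≤ (2 ^ x) ^ 2 := by gcongr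
      _ = 4 ^ x := by rw [← pow_mul, mul_comm, pow_mul]; norm_num
  rw [mul_pow, mul_div_assoc]
  gcongr

lemma summable_succ_sq_mul_poissonPmf {l : ℝ} (hl : 0 < l) :
    Summable fun x : ℕ => ((x : ℝ) + 1) ^ 2 * poissonPmf l x := by
  refine ((summable_succ_sq_mul_pow_div_factorial hl).mul_left (Real.exp (-l))).congr fun x => ?_
  unfold poissonPmf; ring

lemma summable_mul_poissonPmf {l : ℝ} (hl : 0 < l) {f g : ℕ → ℝ}
    (hf : Summable fun x => f x ^ 2 * poissonPmf l x)
    (hg : Summable fun x => g x ^ 2 * poissonPmf l x) :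
    Summable fun x => f x * g x * poissonPmf l x := by
  refine Summable.of_norm_bounded (hf.add hg) fun x => ?_
  have hp := poissonPmf_pos hl x
  rw [Real.norm_eq_abs, abs_mul, abs_of_pos hp, ← add_mul]
  gcongr
  rw [abs_le]
  constructor <;> nlinarith [sq_nonneg (f x + g x), sq_nonneg (f x - g x), sq_nonneg (f x),
    sq_nonneg (g x)]

lemma summable_sq_mul_poissonPmf_of_abs_le {l : ℝ} (hl : 0 < l) {f : ℕ → ℝ} {C : ℝ}
    (hf : ∀ x : ℕ, |f x| ≤ C * ((x : ℝ) + 1)) : Summable fun x => f x ^ 2 * poissonPmf l x := by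
  refine Summable.of_nonneg_of_le (fun x => by have := poissonPmf_pos hl x; positivity)
    (fun x => ?_) ((summable_succ_sq_mul_poissonPmf hl).mul_left (C ^ 2))
  have hp := poissonPmf_pos hl x
  rw [← mul_assoc, ← mul_pow, ← sq_abs (f x)]
  gcongr
  exact hf x

/-- The square of a Poisson mean is at most the mean of the square. -/
lemma sq_tsum_mul_poissonPmf_le {l : ℝ} (hl : 0 < l) {f : ℕ → ℝ}
    (hf : Summable fun x => f x ^ 2 * poissonPmf l x) :
    (∑' x, f x * poissonPmf l x) ^ 2 ≤ ∑' x, f x ^ 2 * poissonPmf l x := by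
  set μ := ∑' x, f x * poissonPmf l x with hμ
  have hp := hasSum_poissonPmf l
  have hf1 : Summable fun x => f x * poissonPmf l x := by
    simpa using summable_mul_poissonPmf hl hf (g := fun _ => 1) (by simpa using hp.summable)
  have h := ((hf.hasSum.sub (hf1.hasSum.mul_left (2 * μ))).add (hp.mul_left (μ ^ 2)))
  have h0 := h.nonneg fun x => by
    have := mul_nonneg (sq_nonneg (f x - μ)) (poissonPmf_pos hl x).le
    linarith
  rw [← hμ] at h0
  linarith

lemma hasDerivAt_poissonPmf {l : ℝ} (hl : 0 < l) (x : ℕ) :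
    HasDerivAt (fun y => poissonPmf y x) ((x - l) / l * poissonPmf l x) l := by
  have h := (((hasDerivAt_neg l).exp).mul (hasDerivAt_pow x l)).div_const (Nat.factorial x : ℝ)
  refine h.congr_deriv ?_
  unfold poissonPmf
  rcases x with _ | n
  · simp [hl.ne']
  · simp only [Nat.add_sub_cancel, Nat.cast_add, Nat.cast_one]
    field_simp
    ring

/-- The Poisson mean of a function with finite second moments may be differentiated under the sum. -/
lemma hasDerivAt_tsum_mul_poissonPmf {f : ℕ → ℝ}
    (hf : ∀ l, 0 < l → Summable fun x => f x ^ 2 * poissonPmf l x) {l : ℝ} (hl : 0 < l) :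
    HasDerivAt (fun y => ∑' x, f x * poissonPmf y x)
      (∑' x : ℕ, f x * ((x - l) / l * poissonPmf l x)) l := by
  have h2l : 0 < 2 * l := by positivity
  have hmem : l ∈ Set.Ioo (l / 2) (2 * l) := ⟨by linarith, by linarith⟩
  have hu : Summable fun x : ℕ =>
      Real.exp (2 * l) * (|f x| * (2 * x / l + 1) * poissonPmf (2 * l) x) := by
    refine (summable_mul_poissonPmf h2l (by simpa using hf _ h2l)
      (summable_sq_mul_poissonPmf_of_abs_le h2l (C := 2 / l + 1) fun x => ?_)).mul_left _
    rw [abs_of_nonneg (by positivity)]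
    have : 0 ≤ 2 / l := by positivity
    have hx : (0 : ℝ) ≤ x := x.cast_nonneg
    rw [mul_div_right_comm]
    nlinarith
  refine hasDerivAt_tsum_of_isPreconnected hu isOpen_Ioo isPreconnected_Ioo
    (g' := fun x y => f x * ((x - y) / y * poissonPmf y x))
    (fun x y hy => (hasDerivAt_poissonPmf (by linarith [hy.1]) x).const_mul (f x))
    (fun x y hy => ?_) hmem ?_ hmem
  · have hy0 : 0 < y := by linarith [hy.1]
    have hp : poissonPmf y x ≤ Real.exp (2 * l) * poissonPmf (2 * l) x := by
      unfold poissonPmf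
      rw [← mul_div_assoc, ← mul_assoc, ← Real.exp_add, add_neg_cancel, Real.exp_zero]
      gcongr
      · simpa using hy0.le
      · exact hy.2.le
    have hq : |((x : ℝ) - y) / y| ≤ 2 * x / l + 1 := by
      rw [sub_div, div_self hy0.ne']
      have h1 : (x : ℝ) / y ≤ 2 * x / l := by
        rw [div_le_div_iff₀ hy0 hl]
        nlinarith [hy.1, (x.cast_nonneg : (0 : ℝ) ≤ x)]
      have h2 : 0 ≤ (x : ℝ) / y := by positivity
      rw [abs_le]
      constructor <;> linarith
    rw [norm_mul, norm_mul, Real.norm_eq_abs, Real.norm_eq_abs, Real.norm_eq_abs,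
      abs_of_pos (poissonPmf_pos hy0 x)]
    calc |f x| * (|((x : ℝ) - y) / y| * poissonPmf y x)
        ≤ |f x| * ((2 * x / l + 1) * (Real.exp (2 * l) * poissonPmf (2 * l) x)) := by
          have := (poissonPmf_pos hy0 x).le
          gcongr
      _ = _ := by ring
  · simpa using summable_mul_poissonPmf hl (hf l hl) (g := fun _ => 1)
      (by simpa using (hasSum_poissonPmf l).summable)

lemma sqRisk_eq_ofReal_tsum {A l : ℝ} (hl : 0 < l) {δ : ℕ → ℝ}
    (h : Summable fun x : ℕ => (δ x - (if A < (x : ℝ) then (1 : ℝ) else 0) * l) ^ 2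
      * poissonPmf l x) :
    sqRisk A l δ = ENNReal.ofReal (∑' x : ℕ,
      (δ x - (if A < (x : ℝ) then (1 : ℝ) else 0) * l) ^ 2 * poissonPmf l x) :=
  (ENNReal.ofReal_tsum_of_nonneg
    (fun x => mul_nonneg (sq_nonneg _) (poissonPmf_pos hl x).le) h).symm

lemma summable_of_sqRisk_ne_top {A l : ℝ} (hl : 0 < l) {δ : ℕ → ℝ} (h : sqRisk A l δ ≠ ⊤) :
    Summable fun x : ℕ => (δ x - (if A < (x : ℝ) then (1 : ℝ) else 0) * l) ^ 2
      * poissonPmf l x := by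
  refine (ENNReal.summable_toReal h).congr fun x => ?_
  exact ENNReal.toReal_ofReal (mul_nonneg (sq_nonneg _) (poissonPmf_pos hl x).le)

open Filter Topology in
/-- If the risk at small `l` is of smaller order than `l ^ m`, then `δ` vanishes at `m`. -/
lemma eq_zero_of_sq_mul_poissonPmf_le {d u C : ℝ} {m : ℕ}
    (h : ∀ l, 0 < l → l ≤ 1 → (d - u * l) ^ 2 * poissonPmf l m ≤ C * l ^ (m + 1)) : d = 0 := by
  have hlim : Tendsto (fun l : ℝ => (d - u * l) ^ 2 * Real.exp (-l) / (Nat.factorial m : ℝ))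
      (𝓝[>] 0) (𝓝 ((d - u * 0) ^ 2 * Real.exp (-0) / (Nat.factorial m : ℝ))) :=
    tendsto_nhdsWithin_of_tendsto_nhds (Continuous.tendsto (by fun_prop) 0)
  have hlim' : Tendsto (fun l : ℝ => C * l) (𝓝[>] 0) (𝓝 (C * 0)) :=
    tendsto_nhdsWithin_of_tendsto_nhds (Continuous.tendsto (by fun_prop) 0)
  have key := le_of_tendsto_of_tendsto hlim hlim' (by
    filter_upwards [Ioc_mem_nhdsGT (zero_lt_one (α := ℝ))] with l hl
    have hlm : 0 < l ^ m := pow_pos hl.1 m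
    refine le_of_mul_le_mul_right ?_ hlm
    calc _ = (d - u * l) ^ 2 * poissonPmf l m := by unfold poissonPmf; ring
      _ ≤ C * l ^ (m + 1) := h l hl.1 hl.2
      _ = _ := by ring)
  have hfac : (0 : ℝ) < Nat.factorial m := by positivity
  simp only [mul_zero, sub_zero, neg_zero, Real.exp_zero, mul_one] at key
  have := (div_le_iff₀ hfac).1 key
  exact pow_eq_zero_iff two_ne_zero |>.1 (le_antisymm (by linarith) (sq_nonneg d))


/-- Theorem 3.1 (`n = 1`): with `U(x) = 1{x > A}`, Robbins' estimator
`V(x) = x·1{x ≥ ⌊A⌋ + 2}` is an admissible estimator of `U(X)λ` under squared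
error loss: any estimator whose risk is nowhere larger has everywhere equal
risk. -/
theorem poisson_V_admissible (A : ℝ) (hA : 0 ≤ A)
    (V : ℕ → ℝ) (hV : ∀ x, V x = if Nat.floor A + 2 ≤ x then (x : ℝ) else 0)
    (δ : ℕ → ℝ)
    (hle : ∀ l : ℝ, 0 < l → sqRisk A l δ ≤ sqRisk A l V) :
    ∀ l : ℝ, 0 < l → sqRisk A l δ = sqRisk A l V := by
  set m := Nat.floor A + 1 with hm
  have hU : ∀ x : ℕ, A < (x : ℝ) ↔ m ≤ x := fun x => (Nat.floor_lt hA).symm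
  have hV' : ∀ x, V x = if m + 1 ≤ x then (x : ℝ) else 0 := hV
  set u : ℕ → ℝ := fun x => if A < (x : ℝ) then 1 else 0 with hu
  have hsV : ∀ l, 0 < l → Summable fun x => (V x - u x * l) ^ 2 * poissonPmf l x := by
    intro l hl
    refine summable_sq_mul_poissonPmf_of_abs_le hl (C := 1 + l) fun x => ?_
    have hx : (0 : ℝ) ≤ x := x.cast_nonneg
    have hxl : 0 ≤ (x : ℝ) * l := by positivity
    rw [hV', abs_le]
    simp only [hu]
    split_ifs <;> constructor <;> nlinarith
  have hsδ : ∀ l, 0 < l → Summable fun x => (δ x - u x * l) ^ 2 * poissonPmf l x := by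
    refine fun l hl => summable_of_sqRisk_ne_top hl ((hle l hl).trans_lt ?_).ne
    rw [sqRisk_eq_ofReal_tsum hl (hsV l hl)]
    exact ENNReal.ofReal_lt_top
  have hrisk : ∀ l, 0 < l → ∑' x, (δ x - u x * l) ^ 2 * poissonPmf l x
      ≤ ∑' x, (V x - u x * l) ^ 2 * poissonPmf l x := by
    intro l hl
    have h := hle l hl
    rw [sqRisk_eq_ofReal_tsum hl (hsV l hl), sqRisk_eq_ofReal_tsum hl (hsδ l hl)] at h
    exact (ENNReal.ofReal_le_ofReal_iff (tsum_nonneg fun x =>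
      mul_nonneg (sq_nonneg _) (poissonPmf_pos hl x).le)).1 h
  have hδm : δ m = 0 := by
    refine eq_zero_of_sq_mul_poissonPmf_le (u := u m) (m := m)
      (C := ∑' x : ℕ, ((x : ℝ) + 1) ^ 2 * (1 ^ x / (Nat.factorial x : ℝ))) fun l hl hl1 => ?_
    refine ((hsδ l hl).le_tsum m fun x _ =>
      mul_nonneg (sq_nonneg _) (poissonPmf_pos hl x).le).trans ((hrisk l hl).trans ?_)
    rw [← tsum_mul_right]
    refine (hsV l hl).tsum_le_tsum (fun x => ?_)
      ((summable_succ_sq_mul_pow_div_factorial one_pos).mul_right _)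
    have hp : poissonPmf l x ≤ l ^ x / (Nat.factorial x : ℝ) := by
      unfold poissonPmf
      gcongr
      exact mul_le_of_le_one_left (by positivity) (Real.exp_le_one_iff.2 (by linarith))
    have hx : (0 : ℝ) ≤ x := x.cast_nonneg
    have hb : (V x - u x * l) ^ 2 * l ^ x ≤ ((x : ℝ) + 1) ^ 2 * l ^ (m + 1) := by
      rw [hV']
      simp only [hu, hU]
      rcases lt_trichotomy x m with h | rfl | h
      · rw [if_neg (by omega), if_neg (by omega)]
        simp only [zero_mul, sub_zero, ne_eq, OfNat.ofNat_ne_zero, not_false_eq_true, zero_pow]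
        positivity
      · rw [if_neg (by omega), if_pos le_rfl]
        calc _ = l ^ (m + 2) := by ring
          _ ≤ l ^ (m + 1) := pow_le_pow_of_le_one hl.le hl1 (by omega)
          _ ≤ _ := le_mul_of_one_le_left (by positivity) (by nlinarith)
      · rw [if_pos (by omega), if_pos h.le, one_mul]
        have h1 : l ^ x ≤ l ^ (m + 1) := pow_le_pow_of_le_one hl.le hl1 h
        have h2 : ((x : ℝ) - l) ^ 2 ≤ ((x : ℝ) + 1) ^ 2 := by nlinarith
        gcongr
    calc _ ≤ (V x - u x * l) ^ 2 * (l ^ x / (Nat.factorial x : ℝ)) := by gcongr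
      _ = (V x - u x * l) ^ 2 * l ^ x / (Nat.factorial x : ℝ) := by ring
      _ ≤ ((x : ℝ) + 1) ^ 2 * l ^ (m + 1) / (Nat.factorial x : ℝ) := by gcongr
      _ = _ := by rw [one_pow]; ring
  set g : ℕ → ℝ := fun x => if m + 1 ≤ x then δ x - V x else 0 with hg
  have hsd : ∀ l, 0 < l → Summable fun x => (δ x - V x) ^ 2 * poissonPmf l x := by
    intro l hl
    refine (((hsδ l hl).add (hsV l hl)).sub
      ((summable_mul_poissonPmf hl (hsδ l hl) (hsV l hl)).mul_left 2)).congr fun x => ?_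
    ring
  have hgd : ∀ l, 0 < l → ∀ x, g x ^ 2 * poissonPmf l x ≤ (δ x - V x) ^ 2 * poissonPmf l x := by
    intro l hl x
    refine mul_le_mul_of_nonneg_right ?_ (poissonPmf_pos hl x).le
    simp only [hg]
    split_ifs
    · exact le_rfl
    · simpa using sq_nonneg (δ x - V x)
  have hsg : ∀ l, 0 < l → Summable fun x => g x ^ 2 * poissonPmf l x := fun l hl =>
    Summable.of_nonneg_of_le (fun x => mul_nonneg (sq_nonneg _) (poissonPmf_pos hl x).le)
      (hgd l hl) (hsd l hl)
  set G' : ℝ → ℝ := fun l => ∑' x : ℕ, g x * ((x - l) / l * poissonPmf l x) with hG'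
  have hG := fun l (hl : 0 < l) => hasDerivAt_tsum_mul_poissonPmf hsg hl
  have hcross : ∀ l, 0 < l → ∀ x : ℕ, (δ x - V x) * (V x - u x * l) * poissonPmf l x
      = l * (g x * ((x - l) / l * poissonPmf l x)) := by
    intro l hl x
    have hV'x := hV' x
    simp only [hg, hu, hU]
    rcases lt_trichotomy x m with h | rfl | h
    · rw [if_neg (by omega), if_neg (by omega), hV'x, if_neg (by omega)]
      ring
    · rw [if_pos le_rfl, if_neg (by omega), hV'x, if_neg (by omega), hδm]
      ring
    · rw [if_pos h.le, if_pos (by omega), hV'x, if_pos (by omega)]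
      field_simp
  have hdiff : ∀ l, 0 < l → ∑' x, (δ x - V x) ^ 2 * poissonPmf l x + 2 * (l * G' l) ≤ 0 := by
    intro l hl
    have h1 := summable_mul_poissonPmf hl (hsd l hl) (hsV l hl)
    have h2 : l * G' l = ∑' x, (δ x - V x) * (V x - u x * l) * poissonPmf l x := by
      rw [hG', ← tsum_mul_left]
      exact tsum_congr fun x => (hcross l hl x).symm
    have h3 : ∑' x, (δ x - u x * l) ^ 2 * poissonPmf l x
        = ∑' x, (δ x - V x) ^ 2 * poissonPmf l x
          + 2 * ∑' x, (δ x - V x) * (V x - u x * l) * poissonPmf l x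
          + ∑' x, (V x - u x * l) ^ 2 * poissonPmf l x := by
      rw [← tsum_mul_left, ← (hsd l hl).tsum_add (h1.mul_left 2),
        ← ((hsd l hl).add (h1.mul_left 2)).tsum_add (hsV l hl)]
      exact tsum_congr fun x => by ring
    rw [h2]
    linarith [hrisk l hl]
  have hG0 : ∀ l, 0 < l → ∑' x, g x * poissonPmf l x = 0 := fun l hl =>
    eq_zero_of_two_mul_mul_deriv_le_neg_sq (f' := G') hG (fun y hy => by
      have h1 := sq_tsum_mul_poissonPmf_le hy (hsg y hy)
      have h2 := (hsg y hy).tsum_le_tsum (hgd y hy) (hsd y hy)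
      linarith [hdiff y hy]) hl
  have hG'1 : G' 1 = 0 := by
    refine (hG 1 one_pos).unique ((hasDerivAt_const (1 : ℝ) (0 : ℝ)).congr_of_eventuallyEq ?_)
    filter_upwards [Ioi_mem_nhds one_pos] with l hl using hG0 l hl
  have hδV : δ = V := by
    funext x
    have h1 := hdiff 1 one_pos
    rw [hG'1] at h1
    have h2 := (hsd 1 one_pos).le_tsum x fun y _ =>
      mul_nonneg (sq_nonneg _) (poissonPmf_pos one_pos y).le
    have h3 : (δ x - V x) ^ 2 ≤ 0 :=
      nonpos_of_mul_nonpos_left (by linarith) (poissonPmf_pos one_pos x)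
    exact sub_eq_zero.1 (pow_eq_zero_iff two_ne_zero |>.1 (le_antisymm h3 (sq_nonneg _)))
  exact fun l _ => by rw [hδV]
end

section
/- Let A ≥ 0 be a real number, U(x) = 0 if x ≤ A and U(x) = 1 if x > A, and let X_1, …, X_n be independent Poisson random variables with means λ_1, …, λ_n > 0. Let S = ∑_{j=1}^n U(X_j)λ_j and V(X) = ∑_{j=1}^n X_j·1{X_j ≥ ⌊A⌋ + 2}. Then V(X) is an admissible estimator of S under squared error loss: for every function δ : ℕ^n → ℝ, if E_λ[(δ(X) − S)²] ≤ E_λ[(V(X) − S)²] for every λ ∈ (0, ∞)^n, then E_λ[(δ(X) − S)²] = E_λ[(V(X) − S)²] for every λ ∈ (0, ∞)^n. -/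
/-- The estimand `S(x, λ) = ∑_j U(x_j)λ_j` with `U(x) = 1{x > A}`. -/
noncomputable def poissonS' (n : ℕ) (A : ℝ) (l : Fin n → ℝ) (x : Fin n → ℕ) : ℝ :=
  ∑ j, (if A < ((x j : ℝ)) then l j else 0)

/-- Squared error risk of the estimator `δ` of `S` when `X_1, …, X_n` are
independent Poisson with means `λ_1, …, λ_n`. -/
noncomputable def sqRiskN (n : ℕ) (A : ℝ) (l : Fin n → ℝ) (δ : (Fin n → ℕ) → ℝ) : ENNReal :=
  ∑' x : Fin n → ℕ,
    ENNReal.ofReal ((δ x - poissonS' n A l x) ^ 2 * ∏ j, poissonPmf (l j) (x j))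

open Filter Topology

/-- The Poisson weight `∏_j l_j ^ x_j / x_j!`, without the exponential normalisation. -/
noncomputable def poissonWeight {n : ℕ} (l : Fin n → ℝ) (x : Fin n → ℕ) : ℝ :=
  ∏ j, l j ^ x j / (Nat.factorial (x j) : ℝ)

/-- The deviation `∑_j (x_j 1{x_j ≥ a + 2} - l_j 1{x_j > a})`. -/
noncomputable def truncDeviation {n : ℕ} (a : ℕ) (l : Fin n → ℝ) (x : Fin n → ℕ) : ℝ :=
  ∑ j, ((if a + 2 ≤ x j then (x j : ℝ) else 0) - (if a < x j then l j else 0))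

theorem poissonWeight_nonneg {n : ℕ} {l : Fin n → ℝ} (hl : ∀ j, 0 ≤ l j) (x : Fin n → ℕ) :
    0 ≤ poissonWeight l x :=
  Finset.prod_nonneg fun j _ => div_nonneg (pow_nonneg (hl j) _) (Nat.cast_nonneg _)

theorem poissonWeight_pos {n : ℕ} {l : Fin n → ℝ} (hl : ∀ j, 0 < l j) (x : Fin n → ℕ) :
    0 < poissonWeight l x :=
  Finset.prod_pos fun j _ => div_pos (pow_pos (hl j) _) (mod_cast Nat.factorial_pos _)

theorem poissonWeight_smul {n : ℕ} (c : ℝ) (l : Fin n → ℝ) (x : Fin n → ℕ) :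
    poissonWeight (fun j => c * l j) x = c ^ (∑ j, x j) * poissonWeight l x := by
  simp only [poissonWeight, mul_pow, ← Finset.prod_pow_eq_pow_sum, ← Finset.prod_mul_distrib,
    mul_div_assoc]

theorem poissonWeight_insertNth {n : ℕ} (i : Fin (n + 1)) (s : ℝ) (l : Fin n → ℝ)
    (x : Fin (n + 1) → ℕ) :
    poissonWeight (i.insertNth (α := fun _ => ℝ) s l) x =
      s ^ x i / (Nat.factorial (x i) : ℝ) * poissonWeight l (i.removeNth x) := by
  simp [poissonWeight, Fin.prod_univ_succAbove _ i, Fin.removeNth]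

theorem truncDeviation_insertNth {n : ℕ} (a : ℕ) (i : Fin (n + 1)) (s : ℝ) (l : Fin n → ℝ)
    (x : Fin (n + 1) → ℕ) :
    truncDeviation a (i.insertNth (α := fun _ => ℝ) s l) x =
      ((if a + 2 ≤ x i then (x i : ℝ) else 0) - (if a < x i then s else 0)) +
        truncDeviation a l (i.removeNth x) := by
  rw [truncDeviation, Fin.sum_univ_succAbove _ i]
  simp only [Fin.insertNth_apply_same, Fin.insertNth_apply_succAbove]
  rfl

theorem hasSum_poissonWeight {n : ℕ} (l : Fin n → ℝ) (hl : ∀ j, 0 ≤ l j) :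
    HasSum (poissonWeight l) (Real.exp (∑ j, l j)) := by
  induction n with
  | zero =>
    have : poissonWeight l = fun _ => 1 := by ext x; simp [poissonWeight]
    rw [this]
    simp
  | succ n ih =>
    have h0 : HasSum (fun k : ℕ => l 0 ^ k / (Nat.factorial k : ℝ)) (Real.exp (l 0)) := by
      rw [Real.exp_eq_exp_ℝ]
      exact NormedSpace.expSeries_div_hasSum_exp (l 0)
    have h1 := ih (fun j => l j.succ) fun j => hl _
    have h2 := h0.mul h1 (h0.summable.mul_of_nonneg h1.summable
      (fun k => div_nonneg (pow_nonneg (hl 0) _) (Nat.cast_nonneg _))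
      (fun x => poissonWeight_nonneg (fun j => hl _) x))
    rw [Fin.sum_univ_succ, Real.exp_add, ← (Fin.consEquiv fun _ => ℕ).hasSum_iff]
    convert! h2 using 2 with p
    simp [poissonWeight, Fin.prod_univ_succ, Fin.consEquiv, mul_div_mul_comm]

theorem summable_poissonWeight_mul_sq {n : ℕ} (l : Fin n → ℝ) (hl : ∀ j, 0 ≤ l j) (c : ℝ) :
    Summable fun x => poissonWeight l x * (((∑ j, x j : ℕ) : ℝ) + c) ^ 2 := by
  have h1 := (hasSum_poissonWeight l hl).summable
  have h4 := (hasSum_poissonWeight (fun j => 4 * l j) fun j => by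
    have := hl j; positivity).summable
  refine Summable.of_nonneg_of_le
    (fun x => mul_nonneg (poissonWeight_nonneg hl x) (sq_nonneg _)) (fun x => ?_)
    ((h4.mul_left 2).add (h1.mul_left (2 * c ^ 2)))
  rw [poissonWeight_smul]
  have hw := poissonWeight_nonneg hl x
  set N := ∑ j, x j
  have hN : (N : ℝ) ^ 2 ≤ 4 ^ N := by
    have : (N : ℝ) ≤ 2 ^ N := by exact_mod_cast (Nat.lt_two_pow_self (n := N)).le
    calc (N : ℝ) ^ 2 ≤ (2 ^ N) ^ 2 := by gcongr
      _ = 4 ^ N := by rw [← pow_mul, mul_comm, pow_mul]; norm_num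
  nlinarith [mul_nonneg hw (sq_nonneg ((N : ℝ) - c)), mul_le_mul_of_nonneg_left hN hw]

theorem abs_truncDeviation_le {n : ℕ} (a : ℕ) {l : Fin n → ℝ} (hl : ∀ j, 0 ≤ l j)
    (x : Fin n → ℕ) : |truncDeviation a l x| ≤ ((∑ j, x j : ℕ) : ℝ) + ∑ j, l j := by
  push_cast
  rw [← Finset.sum_add_distrib]
  refine (Finset.abs_sum_le_sum_abs _ _).trans (Finset.sum_le_sum fun j _ => ?_)
  have h1 := hl j
  have h2 : (0 : ℝ) ≤ x j := Nat.cast_nonneg _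
  split_ifs <;> rw [abs_le] <;> constructor <;> linarith

/-- The quadratic bound used to dominate the excess risk. -/
theorem abs_sq_add_two_mul_le (u d m : ℝ) (h : |d| ≤ m) :
    |u ^ 2 + 2 * u * d| ≤ 2 * u ^ 2 + m ^ 2 := by
  have : d ^ 2 ≤ m ^ 2 := by
    rw [← sq_abs d]
    gcongr
  rw [abs_le]
  constructor <;> nlinarith [sq_nonneg (u + d), sq_nonneg (u - d)]

theorem nonneg_of_riccati {G G' : ℝ → ℝ} (hd : ∀ t > 0, HasDerivAt G (G' t) t)
    (h : ∀ t > 0, G t ^ 2 + 2 * t * G' t ≤ 0) : ∀ t > 0, 0 ≤ G t := by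
  intro t₀ ht₀
  by_contra! hneg
  have hanti : AntitoneOn G (Set.Ioi 0) := by
    refine antitoneOn_of_deriv_nonpos (convex_Ioi 0)
      (fun t ht => (hd t ht).continuousAt.continuousWithinAt) (fun t ht => ?_) (fun t ht => ?_)
    · rw [interior_Ioi] at ht
      exact (hd t ht).differentiableAt.differentiableWithinAt
    · rw [interior_Ioi] at ht
      rw [(hd t ht).deriv]
      have ht' : 0 < t := ht
      by_contra! hc
      nlinarith [h t ht, sq_nonneg (G t), mul_pos ht' hc]
  have hlt : ∀ t, t₀ ≤ t → G t < 0 := fun t ht =>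
    (hanti ht₀ (ht₀.trans_le ht) ht).trans_lt hneg
  have hK : ∀ t, t₀ ≤ t → HasDerivAt (fun t => (G t)⁻¹ - Real.log t / 2)
      (-G' t / G t ^ 2 - t⁻¹ / 2) t := fun t ht =>
    ((hd t (ht₀.trans_le ht)).inv (hlt t ht).ne).sub
      ((Real.hasDerivAt_log (ht₀.trans_le ht).ne').div_const 2)
  have hmono : MonotoneOn (fun t => (G t)⁻¹ - Real.log t / 2) (Set.Ici t₀) := by
    refine monotoneOn_of_deriv_nonneg (convex_Ici t₀)
      (fun t ht => (hK t ht).continuousAt.continuousWithinAt) (fun t ht => ?_) (fun t ht => ?_)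
    · exact (hK t (interior_subset ht)).differentiableAt.differentiableWithinAt
    · have ht' := interior_subset ht
      rw [(hK t ht').deriv]
      have htp : 0 < t := ht₀.trans_le ht'
      have hG : 0 < G t ^ 2 := sq_pos_of_ne_zero (hlt t ht').ne
      have : t⁻¹ / 2 ≤ -G' t / G t ^ 2 := by
        rw [le_div_iff₀ hG, inv_eq_one_div, div_div, div_mul_eq_mul_div, div_le_iff₀ (by positivity)]
        linarith [h t htp]
      linarith
  set k := (G t₀)⁻¹ - Real.log t₀ / 2
  set T := max t₀ (Real.exp (-2 * k))
  have hT : t₀ ≤ T := le_max_left _ _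
  have h1 : k ≤ (G T)⁻¹ - Real.log T / 2 := hmono Set.self_mem_Ici hT hT
  have h2 : -2 * k ≤ Real.log T := by
    rw [Real.le_log_iff_exp_le (ht₀.trans_le hT)]
    exact le_max_right _ _
  have h3 : (G T)⁻¹ < 0 := inv_lt_zero.2 (hlt T hT)
  linarith

theorem eq_zero_of_riccati {G G' : ℝ → ℝ} (hd : ∀ t > 0, HasDerivAt G (G' t) t)
    (h : ∀ t > 0, G t ^ 2 + 2 * t * G' t ≤ 0) : ∀ t > 0, G t = 0 := by
  intro t ht
  refine le_antisymm ?_ (nonneg_of_riccati hd h t ht)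
  have := nonneg_of_riccati (G := fun t => -G t⁻¹) (G' := fun t => G' t⁻¹ / t ^ 2)
    (fun s hs => ?_) (fun s hs => ?_) t⁻¹ (inv_pos.2 ht)
  · simpa using this
  · have := ((hd s⁻¹ (inv_pos.2 hs)).comp s (hasDerivAt_inv hs.ne')).neg
    convert! this using 1
    field_simp
  · have := h s⁻¹ (inv_pos.2 hs)
    have e : 2 * s * (G' s⁻¹ / s ^ 2) = 2 * s⁻¹ * G' s⁻¹ := by field_simp
    rw [e, neg_sq]
    exact this

theorem summable_poissonWeight_mul_excess {n : ℕ} {l : Fin n → ℝ} (hl : ∀ j, 0 ≤ l j)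
    {g d : (Fin n → ℕ) → ℝ} {c : ℝ} (hg : Summable fun x => poissonWeight l x * g x ^ 2)
    (hd : ∀ x, |d x| ≤ ((∑ j, x j : ℕ) : ℝ) + c) :
    Summable fun x => poissonWeight l x * (g x ^ 2 + 2 * g x * d x) := by
  refine Summable.of_norm_bounded
    ((hg.mul_left 2).add (summable_poissonWeight_mul_sq l hl c)) fun x => ?_
  rw [Real.norm_eq_abs, abs_mul, abs_of_nonneg (poissonWeight_nonneg hl x)]
  nlinarith [mul_le_mul_of_nonneg_left (abs_sq_add_two_mul_le (g x) (d x) _ (hd x))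
    (poissonWeight_nonneg hl x)]

theorem summable_poissonWeight_mul_moment {n : ℕ} {l : Fin n → ℝ} (hl : ∀ j, 0 ≤ l j)
    {g : (Fin n → ℕ) → ℝ} (hg : Summable fun x => poissonWeight l x * g x ^ 2) (c : ℝ) :
    Summable fun x => poissonWeight l x * (g x * (((∑ j, x j : ℕ) : ℝ) + c)) := by
  refine Summable.of_norm_bounded (hg.add (summable_poissonWeight_mul_sq l hl c)) fun x => ?_
  have hw := poissonWeight_nonneg hl x
  rw [Real.norm_eq_abs, abs_mul, abs_of_nonneg hw, ← mul_add]
  refine mul_le_mul_of_nonneg_left ?_ hw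
  set m := ((∑ j, x j : ℕ) : ℝ) + c
  rw [abs_le]
  constructor <;> nlinarith [sq_nonneg (g x + m), sq_nonneg (g x - m)]

theorem hasDerivAt_tsum_pow_mul {n : ℕ} {l : Fin n → ℝ} (hl : ∀ j, 0 < l j)
    {g : (Fin n → ℕ) → ℝ}
    (hg : ∀ l : Fin n → ℝ, (∀ j, 0 < l j) → Summable fun x => poissonWeight l x * g x ^ 2)
    {t : ℝ} (ht : 0 < t) :
    HasDerivAt (fun t => ∑' x, t ^ (∑ j, x j) * (poissonWeight l x * g x))
      (∑' x, ((∑ j, x j : ℕ) : ℝ) * t ^ ((∑ j, x j) - 1) * (poissonWeight l x * g x)) t := by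
  have hl' : ∀ s > 0, ∀ j, 0 < s * l j := fun s hs j => mul_pos hs (hl j)
  have hsum : ∀ s > 0, ∀ c : ℝ, Summable fun x : Fin n → ℕ =>
      s ^ (∑ j, x j) * (poissonWeight l x * (g x * (((∑ j, x j : ℕ) : ℝ) + c))) := by
    intro s hs c
    convert! summable_poissonWeight_mul_moment (fun j => (hl' s hs j).le) (hg _ (hl' s hs)) c
      using 2 with x
    rw [poissonWeight_smul, mul_assoc]
  have hsum0 : Summable fun x : Fin n → ℕ => t ^ (∑ j, x j) * (poissonWeight l x * g x) := by
    convert! (hsum t ht 1).sub (hsum t ht 0) using 2 with x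
    ring
  have ht2 : 0 < 2 * t := by positivity
  refine hasDerivAt_tsum_of_isPreconnected (t := Set.Ioo 0 (2 * t)) (y₀ := t)
    (g := fun x t => t ^ (∑ j, x j) * (poissonWeight l x * g x))
    (u := fun x => (2 * t)⁻¹ *
      |(2 * t) ^ (∑ j, x j) * (poissonWeight l x * (g x * (((∑ j, x j : ℕ) : ℝ) + 0)))|)
    ((hsum _ ht2 0).abs.mul_left _) isOpen_Ioo isPreconnected_Ioo
    (fun x y _ => (hasDerivAt_pow _ y).mul_const _) (fun x y hy => ?_) ⟨ht, by linarith⟩ hsum0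
    ⟨ht, by linarith⟩
  have hw := poissonWeight_nonneg (fun j => (hl j).le) x
  rw [Real.norm_eq_abs]
  rcases Nat.eq_zero_or_pos (∑ j, x j) with h0 | h0
  · simp [h0]
  · obtain ⟨N, hN⟩ := Nat.exists_eq_succ_of_ne_zero h0.ne'
    rw [hN, Nat.succ_sub_one, abs_mul, abs_mul, abs_mul, abs_mul, abs_mul, abs_mul, add_zero,
      abs_of_pos (pow_pos ht2 _), abs_of_pos (pow_pos hy.1 _), pow_succ]
    have hp : y ^ N ≤ (2 * t) ^ N := pow_le_pow_left₀ hy.1.le hy.2.le N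
    calc |((N.succ : ℕ) : ℝ)| * y ^ N * (|poissonWeight l x| * |g x|)
        ≤ |((N.succ : ℕ) : ℝ)| * (2 * t) ^ N * (|poissonWeight l x| * |g x|) := by gcongr
      _ = _ := by field_simp

theorem eq_zero_of_excess_along_rays {n : ℕ} {g : (Fin n → ℕ) → ℝ}
    (hg : ∀ l : Fin n → ℝ, (∀ j, 0 < l j) → Summable fun x => poissonWeight l x * g x ^ 2)
    (h : ∀ l : Fin n → ℝ, (∀ j, 0 < l j) →
      ∑' x, poissonWeight l x * (g x ^ 2 + 2 * g x * (((∑ j, x j : ℕ) : ℝ) - ∑ j, l j)) ≤ 0)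
    (x : Fin n → ℕ) : g x = 0 := by
  set l : Fin n → ℝ := fun _ => 1
  have hl : ∀ j, 0 < l j := fun _ => one_pos
  set L := ∑ j, l j
  set F : ℝ → ℝ := fun t => ∑' x, t ^ (∑ j, x j) * (poissonWeight l x * g x)
  set F' : ℝ → ℝ := fun t =>
    ∑' x, ((∑ j, x j : ℕ) : ℝ) * t ^ ((∑ j, x j) - 1) * (poissonWeight l x * g x)
  set Q : ℝ → ℝ := fun t => ∑' x, poissonWeight (fun j => t * l j) x * g x ^ 2
  have hF : ∀ t > 0, HasDerivAt F (F' t) t := fun t ht => hasDerivAt_tsum_pow_mul hl hg ht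
  have hl' : ∀ t > 0, ∀ j, 0 < t * l j := fun t ht j => mul_pos ht (hl j)
  have hLt : ∀ t : ℝ, ∑ j, t * l j = t * L := fun t => by rw [Finset.mul_sum]
  have hS : ∀ t > 0, Summable fun x => poissonWeight (fun j => t * l j) x * g x := by
    intro t ht
    convert! (summable_poissonWeight_mul_moment (fun j => (hl' t ht j).le)
      (hg _ (hl' t ht)) 1).sub (summable_poissonWeight_mul_moment (fun j => (hl' t ht j).le)
      (hg _ (hl' t ht)) 0) using 2 with x
    ring
  have hFS : ∀ t > 0, HasSum (fun x => poissonWeight (fun j => t * l j) x * g x) (F t) := by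
    intro t ht
    convert! (hS t ht).hasSum using 2
    simp only [poissonWeight_smul, mul_assoc]
  have hF'S : ∀ t > 0, HasSum (fun x => poissonWeight (fun j => t * l j) x *
      (g x * (((∑ j, x j : ℕ) : ℝ) + 0))) (t * F' t) := by
    intro t ht
    convert! (summable_poissonWeight_mul_moment (fun j => (hl' t ht j).le)
      (hg _ (hl' t ht)) 0).hasSum using 1
    rw [← tsum_mul_left]
    refine tsum_congr fun x => ?_
    rw [poissonWeight_smul, add_zero]
    rcases Nat.eq_zero_or_pos (∑ j, x j) with h0 | h0
    · simp [h0]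
    · obtain ⟨N, hN⟩ := Nat.exists_eq_succ_of_ne_zero h0.ne'
      rw [hN, Nat.succ_sub_one, pow_succ]
      ring
  have hQS : ∀ t > 0, HasSum (fun x => poissonWeight (fun j => t * l j) x * g x ^ 2) (Q t) :=
    fun t ht => (hg _ (hl' t ht)).hasSum
  have hineq : ∀ t > 0, Q t + 2 * (t * F' t - t * L * F t) ≤ 0 := by
    intro t ht
    refine le_trans (le_of_eq ?_) (h _ (hl' t ht))
    refine (HasSum.tsum_eq ?_).symm
    rw [hLt]
    convert! (hQS t ht).add (((hF'S t ht).sub ((hFS t ht).mul_left (t * L))).mul_left 2)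
      using 2 with x
    ring
  have hCS : ∀ t > 0, ∀ c : ℝ, 2 * c * F t - c ^ 2 * Real.exp (t * L) ≤ Q t := by
    intro t ht c
    have hW := hasSum_poissonWeight (fun j => t * l j) fun j => (hl' t ht j).le
    rw [hLt] at hW
    refine hasSum_le (fun x => ?_) (((hFS t ht).mul_left (2 * c)).sub (hW.mul_left (c ^ 2)))
      (hQS t ht)
    nlinarith [mul_nonneg (poissonWeight_nonneg (fun j => (hl' t ht j).le) x)
      (sq_nonneg (g x - c))]
  set G : ℝ → ℝ := fun t => Real.exp (-(t * L)) * F t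
  set G' : ℝ → ℝ := fun t => Real.exp (-(t * L)) * (F' t - L * F t)
  have hG : ∀ t > 0, HasDerivAt G (G' t) t := by
    intro t ht
    have h1 : HasDerivAt (fun t : ℝ => Real.exp (-(t * L))) (Real.exp (-(t * L)) * (-(1 * L))) t :=
      (((hasDerivAt_id t).mul_const L).neg).exp
    convert! h1.mul (hF t ht) using 1
    simp only [G']
    ring
  have hGz := eq_zero_of_riccati hG fun t ht => by
    have he : 0 < Real.exp (-(t * L)) := Real.exp_pos _
    have hee : Real.exp (-(t * L)) * Real.exp (t * L) = 1 := by rw [← Real.exp_add]; simp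
    have h1 := mul_le_mul_of_nonneg_left (hCS t ht (G t)) he.le
    have h2 := mul_le_mul_of_nonneg_left (hineq t ht) he.le
    have h3 : Real.exp (-(t * L)) * (2 * G t * F t - G t ^ 2 * Real.exp (t * L)) = G t ^ 2 := by
      have : Real.exp (-(t * L)) * F t = G t := rfl
      linear_combination 2 * G t * this - G t ^ 2 * hee
    have h4 : 2 * t * G' t = Real.exp (-(t * L)) * (2 * (t * F' t - t * L * F t)) := by
      simp only [G']; ring
    rw [h4]
    linarith
  have hFz : ∀ t > 0, F t = 0 := fun t ht =>
    (mul_eq_zero.1 (hGz t ht)).resolve_left (Real.exp_ne_zero _)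
  have hF'z : F' 1 = 0 := by
    refine (hF 1 one_pos).unique ((hasDerivAt_const (1 : ℝ) (0 : ℝ)).congr_of_eventuallyEq ?_)
    filter_upwards [lt_mem_nhds (one_pos : (0 : ℝ) < 1)] with t ht using hFz t ht
  have hQ : Q 1 ≤ 0 := by
    have := hineq 1 one_pos
    rw [hF'z, hFz 1 one_pos] at this
    linarith
  have hnn : ∀ x, 0 ≤ poissonWeight (fun j => 1 * l j) x * g x ^ 2 := fun x =>
    mul_nonneg (poissonWeight_nonneg (fun j => (hl' 1 one_pos j).le) x) (sq_nonneg _)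
  have hterm := le_hasSum (hQS 1 one_pos) x fun y _ => hnn y
  have hw := poissonWeight_pos (hl' 1 one_pos) x
  have : g x ^ 2 ≤ 0 := by
    by_contra! hc
    linarith [mul_pos hw hc]
  exact pow_eq_zero_iff two_ne_zero |>.1 (le_antisymm this (sq_nonneg _))

theorem insertNth_nat_injective {n : ℕ} (i : Fin (n + 1)) (k : ℕ) :
    Function.Injective fun y : Fin n → ℕ => i.insertNth (α := fun _ => ℕ) k y := by
  intro y z hyz
  have := congrArg (fun x : Fin (n + 1) → ℕ => i.removeNth x) hyz
  simpa using this

theorem tsum_slice_excess_nonpos {n : ℕ} {a k : ℕ} (hk : k ≤ a + 1) (i : Fin (n + 1))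
    {g : (Fin (n + 1) → ℕ) → ℝ} (hlow : ∀ x, x i < k → g x = 0)
    (hg : ∀ l : Fin (n + 1) → ℝ, (∀ j, 0 < l j) →
      Summable fun x => poissonWeight l x * g x ^ 2)
    (h : ∀ l : Fin (n + 1) → ℝ, (∀ j, 0 < l j) →
      ∑' x, poissonWeight l x * (g x ^ 2 + 2 * g x * truncDeviation a l x) ≤ 0)
    {l : Fin n → ℝ} (hl : ∀ j, 0 < l j) :
    ∑' y : Fin n → ℕ, poissonWeight l y * (g (i.insertNth (α := fun _ => ℕ) k y) ^ 2 +
      2 * g (i.insertNth (α := fun _ => ℕ) k y) * truncDeviation a l y) ≤ 0 := by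
  set e : ℝ → Fin (n + 1) → ℝ := fun s => i.insertNth (α := fun _ => ℝ) s l with he
  have hepos : ∀ s > 0, ∀ j, 0 < e s j := by
    intro s hs j
    refine i.succAboveCases ?_ (fun j => ?_) j
    · simpa [he] using hs
    · simpa [he] using hl j
  set p : ℝ → (Fin (n + 1) → ℕ) → ℝ := fun s x =>
    s ^ (x i - k) * (1 / (Nat.factorial (x i) : ℝ) * poissonWeight l (i.removeNth x)) *
      (g x ^ 2 + 2 * g x * truncDeviation a (e s) x) with hp
  have hpe : ∀ s > 0, ∀ x,
      poissonWeight (e s) x * (g x ^ 2 + 2 * g x * truncDeviation a (e s) x) = s ^ k * p s x := by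
    intro s hs x
    rcases lt_or_ge (x i) k with hx | hx
    · simp [hp, hlow x hx]
    · have : s ^ x i = s ^ k * s ^ (x i - k) := by rw [← pow_add, Nat.add_sub_cancel' hx]
      simp only [hp, he, poissonWeight_insertNth, this]
      ring
  have hple : ∀ s > 0, ∑' x, p s x ≤ 0 := by
    intro s hs
    have := h (e s) (hepos s hs)
    simp only [hpe s hs, tsum_mul_left] at this
    by_contra! hc
    linarith [mul_pos (pow_pos hs k) hc]
  set c : ℝ := 1 + ∑ j, l j
  have hlim : Tendsto (fun s => ∑' x, p s x) (𝓝[>] 0) (𝓝 (∑' x, p 0 x)) := by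
    have h1 : ∀ j, 0 ≤ e 1 j := fun j => (hepos 1 one_pos j).le
    refine tendsto_tsum_of_dominated_convergence
      (bound := fun x => 2 * (poissonWeight (e 1) x * g x ^ 2) +
        poissonWeight (e 1) x * (((∑ j, x j : ℕ) : ℝ) + c) ^ 2)
      (((hg (e 1) (hepos 1 one_pos)).mul_left 2).add (summable_poissonWeight_mul_sq _ h1 c))
      (fun x => ?_) ?_
    · refine tendsto_nhdsWithin_of_tendsto_nhds (Continuous.tendsto ?_ 0)
      simp only [hp, he, truncDeviation_insertNth]
      split_ifs <;> fun_prop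
    · filter_upwards [Ioo_mem_nhdsGT (one_pos : (0 : ℝ) < 1)] with s hs x
      have hw : 0 ≤ poissonWeight (e 1) x := poissonWeight_nonneg h1 x
      have hwe : 1 / (Nat.factorial (x i) : ℝ) * poissonWeight l (i.removeNth x) =
          poissonWeight (e 1) x := by
        simp [he, poissonWeight_insertNth]
      have hd : |truncDeviation a (e s) x| ≤ ((∑ j, x j : ℕ) : ℝ) + c := by
        refine (abs_truncDeviation_le a (fun j => (hepos s hs.1 j).le) x).trans ?_
        have : ∑ j, e s j ≤ c := by
          simp only [he, Fin.sum_univ_succAbove _ i, Fin.insertNth_apply_same,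
            Fin.insertNth_apply_succAbove, c]
          linarith [hs.2]
        linarith
      have hq := abs_sq_add_two_mul_le (g x) _ _ hd
      have hs1 : s ^ (x i - k) ≤ 1 := pow_le_one₀ hs.1.le hs.2.le
      rw [Real.norm_eq_abs, abs_mul, hwe, abs_mul, abs_of_nonneg hw,
        abs_of_nonneg (pow_nonneg hs.1.le _)]
      calc s ^ (x i - k) * poissonWeight (e 1) x *
            |g x ^ 2 + 2 * g x * truncDeviation a (e s) x|
          ≤ 1 * poissonWeight (e 1) x * (2 * g x ^ 2 + (((∑ j, x j : ℕ) : ℝ) + c) ^ 2) := by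
            gcongr
        _ = _ := by ring
  have hp0 : ∑' x, p 0 x ≤ 0 := by
    refine le_of_tendsto hlim ?_
    filter_upwards [self_mem_nhdsWithin] with s hs using hple s hs
  have hinj : Function.Injective fun y : Fin n → ℕ => i.insertNth (α := fun _ => ℕ) k y :=
    insertNth_nat_injective i k
  have hsupp : Function.support (p 0) ⊆
      Set.range fun y : Fin n → ℕ => i.insertNth (α := fun _ => ℕ) k y := by
    intro x hx
    have hxk : x i = k := by
      by_contra hne
      apply hx
      rcases lt_or_gt_of_ne hne with hlt | hgt
      · simp [hp, hlow x hlt]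
      · simp [hp, (Nat.sub_pos_of_lt hgt).ne']
    exact ⟨i.removeNth x, by rw [← hxk]; exact Fin.insertNth_self_removeNth i x⟩
  rw [← hinj.tsum_eq hsupp] at hp0
  have hk2 : ¬ a + 2 ≤ k := by omega
  have hf : (0 : ℝ) < 1 / (Nat.factorial k : ℝ) :=
    one_div_pos.2 (mod_cast Nat.factorial_pos k)
  have hpy : ∀ y : Fin n → ℕ, p 0 (i.insertNth (α := fun _ => ℕ) k y) =
      1 / (Nat.factorial k : ℝ) * (poissonWeight l y *
        (g (i.insertNth (α := fun _ => ℕ) k y) ^ 2 +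
          2 * g (i.insertNth (α := fun _ => ℕ) k y) * truncDeviation a l y)) := by
    intro y
    simp only [hp, he, truncDeviation_insertNth, Fin.insertNth_apply_same,
      Fin.removeNth_insertNth, Nat.sub_self, pow_zero, if_neg hk2, ite_self]
    ring
  simp only [hpy, tsum_mul_left] at hp0
  by_contra! hc
  linarith [mul_pos hf hc]

theorem summable_slice {n : ℕ} (i : Fin (n + 1)) (k : ℕ) {g : (Fin (n + 1) → ℕ) → ℝ}
    {l : Fin n → ℝ} (hg : Summable fun x =>
      poissonWeight (i.insertNth (α := fun _ => ℝ) 1 l) x * g x ^ 2) :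
    Summable fun y => poissonWeight l y * g (i.insertNth (α := fun _ => ℕ) k y) ^ 2 := by
  have hinj : Function.Injective fun y : Fin n → ℕ => i.insertNth (α := fun _ => ℕ) k y :=
    insertNth_nat_injective i k
  have hf : (Nat.factorial k : ℝ) ≠ 0 := mod_cast Nat.factorial_ne_zero k
  convert! (hg.comp_injective hinj).mul_left (Nat.factorial k : ℝ) using 2 with y
  simp only [Function.comp_apply, poissonWeight_insertNth, Fin.insertNth_apply_same,
    Fin.removeNth_insertNth, one_pow]
  field_simp

theorem eq_zero_of_boundary_eq_zero {n : ℕ} (a : ℕ) {g : (Fin n → ℕ) → ℝ}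
    (hg : ∀ l : Fin n → ℝ, (∀ j, 0 < l j) → Summable fun x => poissonWeight l x * g x ^ 2)
    (h : ∀ l : Fin n → ℝ, (∀ j, 0 < l j) →
      ∑' x, poissonWeight l x * (g x ^ 2 + 2 * g x * truncDeviation a l x) ≤ 0)
    (hsmall : ∀ x, (∃ i, x i ≤ a + 1) → g x = 0) (x : Fin n → ℕ) : g x = 0 := by
  refine eq_zero_of_excess_along_rays hg (fun l hl => ?_) x
  refine le_trans (le_of_eq (tsum_congr fun y => ?_)) (h l hl)
  by_cases hy : ∃ i, y i ≤ a + 1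
  · simp [hsmall y hy]
  · push Not at hy
    congr 3
    rw [truncDeviation, Finset.sum_sub_distrib]
    push_cast
    congr 1 <;> refine Finset.sum_congr rfl fun j _ => ?_
    · rw [if_pos (show a + 2 ≤ y j from hy j)]
    · rw [if_pos (by have := hy j; omega)]

theorem eq_zero_of_excess_nonpos {n : ℕ} (a : ℕ) {g : (Fin n → ℕ) → ℝ}
    (hg : ∀ l : Fin n → ℝ, (∀ j, 0 < l j) → Summable fun x => poissonWeight l x * g x ^ 2)
    (h : ∀ l : Fin n → ℝ, (∀ j, 0 < l j) →
      ∑' x, poissonWeight l x * (g x ^ 2 + 2 * g x * truncDeviation a l x) ≤ 0)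
    (x : Fin n → ℕ) : g x = 0 := by
  induction n with
  | zero => exact eq_zero_of_boundary_eq_zero a hg h (fun x ⟨i, _⟩ => i.elim0) x
  | succ n ih =>
    refine eq_zero_of_boundary_eq_zero a hg h ?_ x
    rintro x ⟨i, hi⟩
    suffices hk : ∀ k ≤ a + 1, ∀ x : Fin (n + 1) → ℕ, x i = k → g x = 0 from hk _ hi x rfl
    intro k
    induction k using Nat.strong_induction_on with
    | _ k ihk =>
      intro hk x hx
      have hlow : ∀ x, x i < k → g x = 0 := fun x hx => ihk _ hx (hx.le.trans hk) x rfl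
      have := ih (g := fun y => g (i.insertNth (α := fun _ => ℕ) k y))
        (fun l hl => summable_slice i k (hg _ fun j => ?_))
        (fun l hl => tsum_slice_excess_nonpos hk i hlow hg h hl) (i.removeNth x)
      · rw [← hx] at this
        simpa only [Fin.insertNth_self_removeNth] using this
      · refine i.succAboveCases ?_ (fun j => ?_) j
        · simp
        · simpa using hl j

theorem prod_poissonPmf {n : ℕ} (l : Fin n → ℝ) (x : Fin n → ℕ) :
    ∏ j, poissonPmf (l j) (x j) = Real.exp (-∑ j, l j) * poissonWeight l x := by
  simp only [poissonPmf, poissonWeight, mul_div_assoc, Finset.prod_mul_distrib,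
    ← Finset.sum_neg_distrib, Real.exp_sum]

/-- Theorem 3.1: with `U(x) = 1{x > A}`, the estimator
`V(X) = ∑_j X_j·1{X_j ≥ ⌊A⌋ + 2}` is an admissible estimator of
`S = ∑_j U(X_j)λ_j` under squared error loss: any estimator whose risk is
nowhere larger has everywhere equal risk. -/
theorem poisson_V_admissible_n (n : ℕ) (A : ℝ) (hA : 0 ≤ A)
    (V : (Fin n → ℕ) → ℝ)
    (hV : ∀ x, V x = ∑ j, (if Nat.floor A + 2 ≤ x j then ((x j : ℝ)) else 0))
    (δ : (Fin n → ℕ) → ℝ)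
    (hle : ∀ l : Fin n → ℝ, (∀ j, 0 < l j) → sqRiskN n A l δ ≤ sqRiskN n A l V) :
    ∀ l : Fin n → ℝ, (∀ j, 0 < l j) → sqRiskN n A l δ = sqRiskN n A l V := by
  set D : (Fin n → ℝ) → (Fin n → ℕ) → ℝ := truncDeviation (Nat.floor A) with hD
  have hVS : ∀ l x, V x - poissonS' n A l x = D l x := by
    intro l x
    simp only [hV, poissonS', hD, truncDeviation, Finset.sum_sub_distrib, Nat.floor_lt hA]
  set g : (Fin n → ℕ) → ℝ := fun x => δ x - V x with hg
  have hδS : ∀ l x, δ x - poissonS' n A l x = g x + D l x := by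
    intro l x
    rw [← hVS]
    ring
  have hfac : ∀ l : Fin n → ℝ, ∀ u : (Fin n → ℕ) → ℝ,
      ∑' x, ENNReal.ofReal (u x ^ 2 * (Real.exp (-∑ j, l j) * poissonWeight l x)) =
        ENNReal.ofReal (Real.exp (-∑ j, l j)) *
          ∑' x, ENNReal.ofReal (poissonWeight l x * u x ^ 2) := by
    intro l u
    rw [← ENNReal.tsum_mul_left]
    refine tsum_congr fun x => ?_
    rw [← ENNReal.ofReal_mul (Real.exp_pos _).le]
    congr 1
    ring
  have hle' : ∀ l : Fin n → ℝ, (∀ j, 0 < l j) →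
      ∑' x, ENNReal.ofReal (poissonWeight l x * (g x + D l x) ^ 2) ≤
        ∑' x, ENNReal.ofReal (poissonWeight l x * D l x ^ 2) := by
    intro l hl
    have := hle l hl
    simp only [sqRiskN, prod_poissonPmf, hVS, hδS, hfac] at this
    rwa [ENNReal.mul_le_mul_iff_right
      (ENNReal.ofReal_pos.2 (Real.exp_pos _)).ne' ENNReal.ofReal_ne_top] at this
  have hw : ∀ l : Fin n → ℝ, (∀ j, 0 < l j) → ∀ x, 0 ≤ poissonWeight l x := fun l hl x =>
    (poissonWeight_pos hl x).le
  have hsD : ∀ l : Fin n → ℝ, (∀ j, 0 < l j) →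
      Summable fun x => poissonWeight l x * D l x ^ 2 := by
    intro l hl
    refine Summable.of_nonneg_of_le (fun x => mul_nonneg (hw l hl x) (sq_nonneg _))
      (fun x => mul_le_mul_of_nonneg_left ?_ (hw l hl x))
      (summable_poissonWeight_mul_sq l (fun j => (hl j).le) (∑ j, l j))
    rw [← sq_abs (D l x)]
    gcongr
    exact abs_truncDeviation_le _ (fun j => (hl j).le) x
  have hsδ : ∀ l : Fin n → ℝ, (∀ j, 0 < l j) →
      Summable fun x => poissonWeight l x * (g x + D l x) ^ 2 := by
    intro l hl
    have := ENNReal.summable_toReal (ne_top_of_le_ne_top (hsD l hl).tsum_ofReal_ne_top (hle' l hl))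
    simpa only [ENNReal.toReal_ofReal (mul_nonneg (hw l hl _) (sq_nonneg _))] using this
  have hsg : ∀ l : Fin n → ℝ, (∀ j, 0 < l j) →
      Summable fun x => poissonWeight l x * g x ^ 2 := by
    intro l hl
    refine Summable.of_nonneg_of_le (fun x => mul_nonneg (hw l hl x) (sq_nonneg _)) (fun x => ?_)
      (((hsδ l hl).mul_left 2).add ((hsD l hl).mul_left 2))
    nlinarith [mul_nonneg (hw l hl x) (sq_nonneg (g x + 2 * D l x))]
  have hgz : ∀ x, g x = 0 := eq_zero_of_excess_nonpos (Nat.floor A) hsg fun l hl => by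
    have h1 := hle' l hl
    rw [← ENNReal.ofReal_tsum_of_nonneg (fun x => mul_nonneg (hw l hl x) (sq_nonneg _)) (hsδ l hl),
      ← ENNReal.ofReal_tsum_of_nonneg (fun x => mul_nonneg (hw l hl x) (sq_nonneg _)) (hsD l hl),
      ENNReal.ofReal_le_ofReal_iff (tsum_nonneg fun x => mul_nonneg (hw l hl x) (sq_nonneg _)),
      ← sub_nonpos, ← (hsδ l hl).tsum_sub (hsD l hl)] at h1
    refine le_trans (le_of_eq (tsum_congr fun x => ?_)) h1
    simp only [hD]
    ring
  have hδ : δ = V := funext fun x => sub_eq_zero.1 (hgz x)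
  intro l _
  rw [hδ]
end
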